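/- Let (M_n)_{n≥1} be a sequence of positive real numbers with ∑_{n=1}^∞ M_n^{-1/n} = ∞. Let a < b be reals and let f be a smooth function on (a, b) such that there exists a constant A > 0 with sup_{x ∈ (a,b)} |f^{(n)}(x)| ≤ Aⁿ M_n for every n ≥ 1. If there exists a point x₀ ∈ (a, b) with f(x₀) = 0 and f^{(n)}(x₀) = 0 for every n ≥ 1, then f is identically zero on (a, b). (Denjoy's sufficiency half of the Denjoy–Carleman theorem.) -/

import Mathlib

open Set

/-- Carleman's inequality for finite sums, with the constant `2e`. -/
theorem carleman_inequality (a : ℕ → ℝ) (ha : ∀ k, 0 < a k) (N : ℕ) :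
    ∑ i ∈ Finset.range N, (∏ k ∈ Finset.range (i + 1), a k) ^ ((1 : ℝ) / ((i : ℝ) + 1)) ≤
      2 * Real.exp 1 * ∑ k ∈ Finset.range N, a k := by
  have hamgm : ∀ i : ℕ, (∏ k ∈ Finset.range (i + 1), a k) ^ ((1 : ℝ) / ((i : ℝ) + 1)) ≤
      Real.exp 1 * ((∑ k ∈ Finset.range (i + 1), ((k : ℝ) + 1) * a k) / ((i : ℝ) + 1) ^ 2) := by
    intro i
    have hi : (0 : ℝ) < (i : ℝ) + 1 := by positivity
    have hP : 0 < ∏ k ∈ Finset.range (i + 1), a k := Finset.prod_pos fun k _ => ha k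
    have h := Real.geom_mean_le_arith_mean (Finset.range (i + 1)) (fun _ => (1 : ℝ))
      (fun k => ((k : ℝ) + 1) * a k) (fun _ _ => zero_le_one) (by simp; positivity)
      (fun k _ => by have := ha k; positivity)
    have hfac : ∏ k ∈ Finset.range (i + 1), ((k : ℝ) + 1) = ((i + 1).factorial : ℝ) := by
      rw [← Finset.prod_range_add_one_eq_factorial]
      push_cast
      rfl
    simp only [Real.rpow_one, one_mul, Finset.sum_const, Finset.card_range, nsmul_eq_mul,
      mul_one, Finset.prod_mul_distrib, hfac] at h
    push_cast at h
    rw [Real.mul_rpow (by positivity) hP.le] at h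
    have hstir : ((i : ℝ) + 1) / Real.exp 1 ≤
        ((i + 1).factorial : ℝ) ^ ((i : ℝ) + 1)⁻¹ := by
      have h1 := Real.pow_div_factorial_le_exp ((i : ℝ) + 1) hi.le (i + 1)
      rw [div_le_iff₀ (by positivity)] at h1
      have h2 : (((i : ℝ) + 1) / Real.exp 1) ^ (i + 1) ≤ ((i + 1).factorial : ℝ) := by
        rw [div_pow, ← Real.exp_nat_mul, div_le_iff₀ (Real.exp_pos _)]
        push_cast
        rw [mul_one, mul_comm]
        exact h1
      have h3 := Real.rpow_le_rpow (by positivity) h2 (inv_nonneg.2 hi.le)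
      have h4 := Real.pow_rpow_inv_natCast (x := ((i : ℝ) + 1) / Real.exp 1) (n := i + 1)
        (by positivity) (by omega)
      push_cast at h4
      rwa [h4] at h3
    have hP' : 0 ≤ (∏ k ∈ Finset.range (i + 1), a k) ^ ((i : ℝ) + 1)⁻¹ :=
      Real.rpow_nonneg hP.le _
    have h5 := (mul_le_mul_of_nonneg_right hstir hP').trans h
    rw [one_div]
    rw [div_mul_eq_mul_div, div_le_iff₀ (Real.exp_pos 1)] at h5
    rw [← mul_div_assoc, le_div_iff₀ (by positivity)]
    rw [div_mul_eq_mul_div, le_div_iff₀ hi] at h5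
    linarith
  have hsum : ∑ i ∈ Finset.range N,
        (∑ k ∈ Finset.range (i + 1), ((k : ℝ) + 1) * a k) / ((i : ℝ) + 1) ^ 2 +
      (∑ k ∈ Finset.range N, ((k : ℝ) + 1) * a k) / ((N : ℝ) + 1 / 2) ≤
      2 * ∑ k ∈ Finset.range N, a k := by
    induction N with
    | zero => simp
    | succ N ih =>
      rw [Finset.sum_range_succ, Finset.sum_range_succ a]
      set S := ∑ k ∈ Finset.range (N + 1), ((k : ℝ) + 1) * a k with hS
      have hS' : S = ∑ k ∈ Finset.range N, ((k : ℝ) + 1) * a k + ((N : ℝ) + 1) * a N := by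
        rw [hS, Finset.sum_range_succ]
      have hS0 : 0 ≤ S := Finset.sum_nonneg fun k _ => by have := ha k; positivity
      have hcoef : 1 / ((N : ℝ) + 1) ^ 2 + 1 / ((N : ℝ) + 1 + 1 / 2) ≤ 1 / ((N : ℝ) + 1 / 2) := by
        rw [div_add_div _ _ (by positivity) (by positivity), div_le_div_iff₀ (by positivity)
          (by positivity)]
        nlinarith
      have hlast : (((N : ℝ) + 1) * a N) / ((N : ℝ) + 1 / 2) ≤ 2 * a N := by
        rw [div_le_iff₀ (by positivity)]
        nlinarith [ha N, mul_nonneg (Nat.cast_nonneg (α := ℝ) N) (ha N).le]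
      have h1 := mul_le_mul_of_nonneg_left hcoef hS0
      have h2 : S * (1 / ((N : ℝ) + 1 / 2)) =
          (∑ k ∈ Finset.range N, ((k : ℝ) + 1) * a k) / ((N : ℝ) + 1 / 2) +
          (((N : ℝ) + 1) * a N) / ((N : ℝ) + 1 / 2) := by
        rw [hS']; ring
      have h3 : S * (1 / ((N : ℝ) + 1) ^ 2 + 1 / ((N : ℝ) + 1 + 1 / 2)) =
          S / ((N : ℝ) + 1) ^ 2 + S / ((N : ℝ) + 1 + 1 / 2) := by ring
      push_cast
      linarith
  have hrem : 0 ≤ (∑ k ∈ Finset.range N, ((k : ℝ) + 1) * a k) / ((N : ℝ) + 1 / 2) :=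
    div_nonneg (Finset.sum_nonneg fun k _ => by have := ha k; positivity) (by positivity)
  calc _ ≤ ∑ i ∈ Finset.range N, Real.exp 1 *
        ((∑ k ∈ Finset.range (i + 1), ((k : ℝ) + 1) * a k) / ((i : ℝ) + 1) ^ 2) :=
        Finset.sum_le_sum fun i _ => hamgm i
    _ ≤ Real.exp 1 * (2 * ∑ k ∈ Finset.range N, a k) := by
        rw [← Finset.mul_sum]
        exact mul_le_mul_of_nonneg_left (by linarith) (Real.exp_pos 1).le
    _ = _ := by ring

/-- Geometric bounds `δ Rⁿ` on the derivatives of order at most `N` at `x` propagate to the right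
with an exponential loss, provided the bound on the `N`-th derivative is uniform. -/
theorem norm_le_geometric_mul_exp {E : Type*} [NormedAddCommGroup E] [NormedSpace ℝ E]
    {G : ℕ → ℝ → E} {x ℓ R δ : ℝ} {N : ℕ} (hR : 0 ≤ R) (hδ : 0 ≤ δ)
    (hG : ∀ n, ∀ t ∈ Icc x ℓ, HasDerivAt (G n) (G (n + 1) t) t)
    (hN : ∀ t ∈ Icc x ℓ, ‖G N t‖ ≤ δ * R ^ N)
    (hx : ∀ n ≤ N, ‖G n x‖ ≤ δ * R ^ n) {n : ℕ} (hn : n ≤ N) :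
    ∀ y ∈ Icc x ℓ, ‖G n y‖ ≤ δ * R ^ n * Real.exp (R * (y - x)) := by
  induction hn using Nat.decreasingInduction with
  | self =>
    intro y hy
    refine (hN y hy).trans (le_mul_of_one_le_right (by positivity) ?_)
    exact Real.one_le_exp (mul_nonneg hR (sub_nonneg.2 hy.1))
  | of_succ n hn ih =>
    intro y hy
    have hB : ∀ t, HasDerivAt (fun t => δ * R ^ n * Real.exp (R * (t - x)))
        (δ * R ^ (n + 1) * Real.exp (R * (t - x))) t := by
      intro t
      have h := ((((hasDerivAt_id t).sub_const x).const_mul R).exp).const_mul (δ * R ^ n)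
      refine h.congr_deriv ?_
      simp only [id]
      ring
    refine image_norm_le_of_norm_deriv_right_le_deriv_boundary (f := G n) (f' := G (n + 1))
      (fun t ht => (hG n t ht).continuousAt.continuousWithinAt)
      (fun t ht => (hG n t (Ico_subset_Icc_self ht)).hasDerivWithinAt) ?_ hB
      (fun t ht => ih t (Ico_subset_Icc_self ht)) hy
    simpa using hx n hn.le

/-- The steepest geometric slope of a positive sequence to the left of `N`. -/
theorem exists_max_geometric_slope {m : ℕ → ℝ} (hm : ∀ n, 0 < m n) {N : ℕ} (hN : 0 < N) :
    ∃ s : ℝ, 0 < s ∧ (∀ n < N, m N ≤ s ^ (N - n) * m n) ∧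
      ∃ N' < N, m N = s ^ (N - N') * m N' := by
  obtain ⟨N', hN', hmax⟩ := Finset.exists_max_image (Finset.range N)
    (fun n => (m N / m n) ^ (((N - n : ℕ) : ℝ)⁻¹)) ⟨0, by simpa using hN⟩
  rw [Finset.mem_range] at hN'
  have hpow : ∀ n < N, ((m N / m n) ^ (((N - n : ℕ) : ℝ)⁻¹)) ^ (N - n) = m N / m n :=
    fun n hn => Real.rpow_inv_natCast_pow (div_pos (hm N) (hm n)).le (by omega)
  refine ⟨(m N / m N') ^ (((N - N' : ℕ) : ℝ)⁻¹),
    Real.rpow_pos_of_pos (div_pos (hm N) (hm N')) _, fun n hn => ?_, N', hN', ?_⟩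
  · rw [← div_le_iff₀ (hm n), ← hpow n hn]
    exact pow_le_pow_left₀ (Real.rpow_nonneg (div_pos (hm N) (hm n)).le _)
      (hmax n (Finset.mem_range.2 hn)) _
  · rw [hpow N' hN', div_mul_cancel₀ _ (hm N').ne']

/-- Bang's propagation argument along the log-convex minorant of `m`, whose successive ratios
are the `ρ k`. -/
theorem exists_ratios_norm_le {E : Type*} [NormedAddCommGroup E] [NormedSpace ℝ E]
    {G : ℕ → ℝ → E} {ℓ : ℝ} {m : ℕ → ℝ} (hm : ∀ n, 0 < m n)
    (hG : ∀ n, ∀ t ∈ Icc 0 ℓ, HasDerivAt (G n) (G (n + 1) t) t)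
    (hbound : ∀ n, 1 ≤ n → ∀ t ∈ Icc 0 ℓ, ‖G n t‖ ≤ m n) (N : ℕ) :
    ∃ ρ : ℕ → ℝ, (∀ k, 0 < ρ k) ∧
      (∀ n ≤ N, m 0 * ∏ k ∈ Finset.range n, ρ k ≤ m n) ∧
      ∀ r, 0 < r → (∀ n < N, m N ≤ r ^ (N - n) * m n) →
      ∀ x, 0 ≤ x → (∀ n ≤ N, ‖G n x‖ * (Real.exp 1 * r) ^ (N - n) ≤ m N) →
      ∀ y, x ≤ y → y ≤ ℓ → y - x ≤ ∑ k ∈ Finset.range N, (Real.exp 1 * ρ k)⁻¹ →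
      ‖G 0 y‖ ≤ m 0 := by
  induction N using Nat.strong_induction_on with
  | _ N ih =>
  rcases Nat.eq_zero_or_pos N with rfl | hN
  · refine ⟨fun _ => 1, fun _ => one_pos, fun n hn => ?_, fun r _ _ x _ hx y hxy _ hy => ?_⟩
    · obtain rfl : n = 0 := by omega
      simp
    · obtain rfl : y = x := by
        simp only [Finset.range_zero, Finset.sum_empty] at hy
        linarith
      simpa using hx 0 le_rfl
  obtain ⟨s, hs, hslope, N', hN', heq⟩ := exists_max_geometric_slope hm hN
  obtain ⟨ρ', hρ', hmin', hprop⟩ := ih N' hN'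
  have hNN' : N = N' + (N - N') := by omega
  refine ⟨fun k => if k < N' then ρ' k else s, fun k => ?_, fun n hn => ?_, ?_⟩
  · dsimp only
    split_ifs
    exacts [hρ' k, hs]
  · rcases le_or_gt n N' with h | h
    · rw [Finset.prod_congr rfl fun k hk => if_pos ((Finset.mem_range.1 hk).trans_le h)]
      exact hmin' n h
    · obtain ⟨d, rfl⟩ := Nat.exists_eq_add_of_le h.le
      have h1 : ∏ k ∈ Finset.range (N' + d), (if k < N' then ρ' k else s) =
          (∏ k ∈ Finset.range N', ρ' k) * s ^ d := by
        rw [Finset.prod_range_add]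
        congr 1
        · exact Finset.prod_congr rfl fun k hk => if_pos (Finset.mem_range.1 hk)
        · simp
      rw [h1, ← mul_assoc]
      refine (mul_le_mul_of_nonneg_right (hmin' N' le_rfl) (pow_pos hs d).le).trans ?_
      have h2 : m N ≤ s ^ (N - (N' + d)) * m (N' + d) := by
        rcases hn.lt_or_eq with h | h
        · exact hslope _ h
        · rw [h]; simp
      have h3 : s ^ (N - N') = s ^ (N - (N' + d)) * s ^ d := by
        rw [← pow_add]; congr 1; omega
      rw [heq, h3] at h2
      refine le_of_mul_le_mul_left ?_ (pow_pos hs (N - (N' + d)))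
      linarith
  intro r hr hr' x hx0 hx y hxy hyl hy
  have he := Real.exp_pos 1
  have hsr : s ≤ r := by
    have h := hr' N' hN'
    rw [heq] at h
    exact le_of_pow_le_pow_left₀ (by omega) hr.le (le_of_mul_le_mul_right h (hm N'))
  set R := Real.exp 1 * s with hRdef
  have hR : 0 < R := by positivity
  set δ := m N / R ^ N with hδdef
  have hδ : 0 < δ := div_pos (hm N) (pow_pos hR N)
  have hδN : δ * R ^ N = m N := div_mul_cancel₀ _ (pow_pos hR N).ne'
  have hsub : Icc x ℓ ⊆ Icc 0 ℓ := Icc_subset_Icc_left hx0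
  have htravel := fun (n : ℕ) (hn : n ≤ N) => norm_le_geometric_mul_exp (G := G) (x := x) (ℓ := ℓ)
    (N := N) hR.le hδ.le (fun n t ht => hG n t (hsub ht))
    (fun t ht => by rw [hδN]; exact hbound N hN t (hsub ht))
    (fun n hn => by
      have h1 : ‖G n x‖ * R ^ (N - n) ≤ m N := (mul_le_mul_of_nonneg_left
        (pow_le_pow_left₀ hR.le (mul_le_mul_of_nonneg_left hsr he.le) _) (norm_nonneg _)).trans
          (hx n hn)
      have h2 : R ^ N = R ^ n * R ^ (N - n) := by rw [← pow_add]; congr 1; omega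
      rw [← hδN, h2, ← mul_assoc] at h1
      exact le_of_mul_le_mul_right h1 (pow_pos hR _)) hn
  have hsum : ∑ k ∈ Finset.range N, (Real.exp 1 * (if k < N' then ρ' k else s))⁻¹ =
      ∑ k ∈ Finset.range N', (Real.exp 1 * ρ' k)⁻¹ + ((N - N' : ℕ) : ℝ) * R⁻¹ := by
    conv_lhs => rw [hNN']
    rw [Finset.sum_range_add]
    congr 1
    · exact Finset.sum_congr rfl fun k hk => by rw [if_pos (Finset.mem_range.1 hk)]
    · simp [hRdef]
  have hsum0 : 0 ≤ ∑ k ∈ Finset.range N', (Real.exp 1 * ρ' k)⁻¹ :=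
    Finset.sum_nonneg fun k _ => by have := hρ' k; positivity
  rw [hsum] at hy
  set z := min y (x + ((N - N' : ℕ) : ℝ) * R⁻¹) with hz
  have hxz : x ≤ z := le_min hxy (le_add_of_nonneg_right (by positivity))
  have hzy : z ≤ y := min_le_left _ _
  refine hprop s hs (fun n hn => ?_) z (hx0.trans hxz) (fun n hn => ?_) y hzy hyl ?_
  · have h := hslope n (hn.trans hN')
    rw [heq, show N - n = (N - N') + (N' - n) by omega, pow_add, mul_assoc] at h
    exact le_of_mul_le_mul_left h (pow_pos hs _)
  · have h := htravel n (hn.trans hN'.le) z ⟨hxz, hzy.trans hyl⟩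
    have hexp : Real.exp (R * (z - x)) ≤ Real.exp 1 ^ (N - N') := by
      rw [← Real.exp_nat_mul, mul_one]
      refine Real.exp_le_exp.2 ?_
      have h1 : z - x ≤ ((N - N' : ℕ) : ℝ) * R⁻¹ := by
        linarith [min_le_right y (x + ((N - N' : ℕ) : ℝ) * R⁻¹)]
      calc R * (z - x) ≤ R * (((N - N' : ℕ) : ℝ) * R⁻¹) := mul_le_mul_of_nonneg_left h1 hR.le
        _ = _ := by field_simp
    have hδ' : δ * R ^ N' * Real.exp 1 ^ (N - N') = m N' := by
      have h2 : R ^ N = R ^ N' * (Real.exp 1 ^ (N - N') * s ^ (N - N')) := by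
        rw [← mul_pow, ← hRdef, ← pow_add, ← hNN']
      rw [h2, heq] at hδN
      refine mul_right_cancel₀ (pow_pos hs (N - N')).ne' ?_
      linarith
    calc ‖G n z‖ * R ^ (N' - n)
        ≤ (δ * R ^ n * Real.exp 1 ^ (N - N')) * R ^ (N' - n) :=
          mul_le_mul_of_nonneg_right
            (h.trans (mul_le_mul_of_nonneg_left hexp (by positivity))) (by positivity)
      _ = δ * (R ^ n * R ^ (N' - n)) * Real.exp 1 ^ (N - N') := by ring
      _ = m N' := by rw [← pow_add, Nat.add_sub_cancel' hn, hδ']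
  · rcases min_choice y (x + ((N - N' : ℕ) : ℝ) * R⁻¹) with h | h
    · rw [hz, h]; simpa using hsum0
    · rw [hz, h]; linarith

/-- One-sided quasi-analyticity for a sequence `G n` of successive derivatives on `[0, ℓ]`. -/
theorem eq_zero_of_not_summable_of_flat {E : Type*} [NormedAddCommGroup E] [NormedSpace ℝ E]
    {G : ℕ → ℝ → E} {ℓ : ℝ} (hℓ : 0 ≤ ℓ) {M : ℕ → ℝ} (hM : ∀ n : ℕ, 1 ≤ n → 0 < M n)
    (hdiv : ¬ Summable (fun n : ℕ => M (n + 1) ^ (-(1 : ℝ) / ((n : ℝ) + 1))))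
    {A : ℝ} (hA : 0 < A)
    (hG : ∀ n, ∀ t ∈ Icc 0 ℓ, HasDerivAt (G n) (G (n + 1) t) t)
    (hbound : ∀ n, 1 ≤ n → ∀ t ∈ Icc 0 ℓ, ‖G n t‖ ≤ A ^ n * M n)
    (hflat : ∀ n, G n 0 = 0) : G 0 ℓ = 0 := by
  suffices h : ∀ ε : ℝ, 0 < ε → ε ≤ 1 → ‖G 0 ℓ‖ ≤ ε by
    rw [← norm_le_zero_iff]
    refine le_of_forall_pos_le_add fun ε hε => ?_
    rw [zero_add]
    exact (h (min ε 1) (lt_min hε one_pos) (min_le_right _ _)).trans (min_le_left _ _)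
  intro ε hε hε1
  have he := Real.exp_pos 1
  set m : ℕ → ℝ := fun n => if n = 0 then ε else A ^ n * M n with hmdef
  have hmsucc : ∀ n, m (n + 1) = A ^ (n + 1) * M (n + 1) := fun n => if_neg n.succ_ne_zero
  have hm : ∀ n, 0 < m n := by
    intro n
    rcases n with _ | n
    · simpa [hmdef] using hε
    · rw [hmsucc]
      exact mul_pos (pow_pos hA _) (hM _ (by omega))
  have hnonneg : ∀ n : ℕ, 0 ≤ M (n + 1) ^ (-(1 : ℝ) / ((n : ℝ) + 1)) :=
    fun n => Real.rpow_nonneg (hM _ (by omega)).le _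
  have htop := (not_summable_iff_tendsto_nat_atTop_of_nonneg hnonneg).1 hdiv
  obtain ⟨N, hN⟩ := (htop.eventually_ge_atTop
    (2 * Real.exp 1 * (Real.exp 1 * ℓ) * (A / ε))).exists
  obtain ⟨ρ, hρ, hmin, hprop⟩ := exists_ratios_norm_le (G := G) (ℓ := ℓ) hm hG
    (fun n hn t ht => by
      obtain ⟨k, rfl⟩ := Nat.exists_eq_add_of_le' hn
      rw [hmsucc]
      exact hbound _ hn t ht) N
  have hterm : ∀ i ∈ Finset.range N, ε / A * M (i + 1) ^ (-(1 : ℝ) / ((i : ℝ) + 1)) ≤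
      (∏ k ∈ Finset.range (i + 1), (ρ k)⁻¹) ^ ((1 : ℝ) / ((i : ℝ) + 1)) := by
    intro i hi
    have hi' : (0 : ℝ) < (i : ℝ) + 1 := by positivity
    have hMi := hM (i + 1) (by omega)
    have h := hmin (i + 1) (Finset.mem_range.1 hi)
    have hP : 0 < ∏ k ∈ Finset.range (i + 1), ρ k := Finset.prod_pos fun k _ => hρ k
    have h0 : m 0 = ε := if_pos rfl
    rw [hmsucc, h0] at h
    have hle : ε / (A ^ (i + 1) * M (i + 1)) ≤ ∏ k ∈ Finset.range (i + 1), (ρ k)⁻¹ := by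
      rw [Finset.prod_inv_distrib, div_le_iff₀ (by positivity), inv_mul_eq_div,
        le_div_iff₀ hP]
      exact h
    refine le_trans ?_ (Real.rpow_le_rpow (by positivity) hle (by positivity))
    have hAroot : (A ^ (i + 1)) ^ ((1 : ℝ) / ((i : ℝ) + 1)) = A := by
      have h4 := Real.pow_rpow_inv_natCast (x := A) (n := i + 1) hA.le (by omega)
      push_cast at h4
      rwa [one_div]
    have hεroot : ε ≤ ε ^ ((1 : ℝ) / ((i : ℝ) + 1)) := by
      have h5 : (1 : ℝ) / ((i : ℝ) + 1) ≤ 1 := by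
        rw [div_le_one hi']
        linarith [Nat.cast_nonneg (α := ℝ) i]
      simpa using Real.rpow_le_rpow_of_exponent_ge hε hε1 h5
    rw [Real.div_rpow hε.le (by positivity), Real.mul_rpow (by positivity) hMi.le, hAroot,
      neg_div, Real.rpow_neg hMi.le, ← div_eq_mul_inv, div_div]
    exact div_le_div_of_nonneg_right hεroot
      (mul_nonneg hA.le (Real.rpow_nonneg hMi.le _))
  have hcarleman := (Finset.sum_le_sum hterm).trans
    (carleman_inequality (fun k => (ρ k)⁻¹) (fun k => inv_pos.2 (hρ k)) N)
  rw [← Finset.mul_sum] at hcarleman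
  have hdist : ℓ - 0 ≤ ∑ k ∈ Finset.range N, (Real.exp 1 * ρ k)⁻¹ := by
    have h1 := (mul_le_mul_of_nonneg_left hN (div_pos hε hA).le).trans hcarleman
    have h2 : ε / A * (2 * Real.exp 1 * (Real.exp 1 * ℓ) * (A / ε)) =
        2 * Real.exp 1 * (Real.exp 1 * ℓ) := by field_simp
    rw [h2] at h1
    have h3 := le_of_mul_le_mul_left h1 (by positivity)
    simp only [mul_inv]
    rw [← Finset.mul_sum, sub_zero, inv_mul_eq_div, le_div_iff₀ he]
    linarith
  have hr : ∃ r : ℝ, 0 < r ∧ ∀ n < N, m N ≤ r ^ (N - n) * m n := by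
    rcases Nat.eq_zero_or_pos N with h | h
    · exact ⟨1, one_pos, fun n hn => by omega⟩
    · obtain ⟨s, hs, hslope, -⟩ := exists_max_geometric_slope hm h
      exact ⟨s, hs, hslope⟩
  obtain ⟨r, hr0, hr⟩ := hr
  have h := hprop r hr0 hr 0 le_rfl (fun n _ => by simpa [hflat n] using (hm N).le) ℓ hℓ le_rfl
    hdist
  simpa [hmdef] using h

/-- Denjoy's sufficiency half of the Denjoy–Carleman theorem: if `∑ Mₙ^{-1/n} = ∞`
and `f` is a smooth function on `(a,b)` whose derivatives satisfy
`sup_{(a,b)} |f^{(n)}| ≤ Aⁿ Mₙ` for all `n ≥ 1`, then the vanishing of `f` and all of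
its derivatives at a single point `x₀ ∈ (a,b)` forces `f ≡ 0` on `(a,b)`. -/
theorem denjoy_carleman_quasianalytic (M : ℕ → ℝ) (hM : ∀ n : ℕ, 1 ≤ n → 0 < M n)
    (hdiv : ¬ Summable (fun n : ℕ => M (n + 1) ^ (-(1 : ℝ) / ((n : ℝ) + 1))))
    (a b : ℝ) (hab : a < b) (f : ℝ → ℂ) (hf : ContDiffOn ℝ (⊤ : ℕ∞) f (Ioo a b))
    (A : ℝ) (hA : 0 < A)
    (hbound : ∀ n : ℕ, 1 ≤ n → ∀ x ∈ Ioo a b,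
      ‖iteratedDerivWithin n f (Ioo a b) x‖ ≤ A ^ n * M n)
    (x₀ : ℝ) (hx₀ : x₀ ∈ Ioo a b) (h0 : f x₀ = 0)
    (hvan : ∀ n : ℕ, 1 ≤ n → iteratedDerivWithin n f (Ioo a b) x₀ = 0) :
    EqOn f 0 (Ioo a b) := by
  set D : ℕ → ℝ → ℂ := fun n => iteratedDerivWithin n f (Ioo a b) with hD
  have hderiv : ∀ n, ∀ x ∈ Ioo a b, HasDerivAt (D n) (D (n + 1) x) x := by
    intro n x hx
    have h := hf.differentiableOn_iteratedDerivWithin (m := n)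
      (by exact_mod_cast WithTop.coe_lt_top n) isOpen_Ioo.uniqueDiffOn x hx
    have h' := h.hasDerivWithinAt.hasDerivAt (isOpen_Ioo.mem_nhds hx)
    rwa [← iteratedDerivWithin_succ] at h'
  have hflat : ∀ n, D n x₀ = 0 := by
    intro n
    rcases n with _ | n
    · simpa [hD] using h0
    · exact hvan _ (by omega)
  intro y hy
  rcases le_total x₀ y with hxy | hxy
  · have hmem : ∀ t ∈ Icc 0 (y - x₀), x₀ + t ∈ Ioo a b := fun t ht =>
      ⟨by linarith [ht.1, hx₀.1], by linarith [ht.2, hy.2]⟩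
    have h := eq_zero_of_not_summable_of_flat (G := fun n t => D n (x₀ + t)) (sub_nonneg.2 hxy)
      hM hdiv hA (fun n t ht => (hderiv n _ (hmem t ht)).comp_const_add x₀ t)
      (fun n hn t ht => hbound n hn _ (hmem t ht)) (fun n => by simpa using hflat n)
    simpa [hD] using h
  · have hmem : ∀ t ∈ Icc 0 (x₀ - y), x₀ - t ∈ Ioo a b := fun t ht =>
      ⟨by linarith [ht.2, hy.1], by linarith [ht.1, hx₀.2]⟩
    have h := eq_zero_of_not_summable_of_flat (G := fun n t => (-1 : ℝ) ^ n • D n (x₀ - t))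
      (sub_nonneg.2 hxy) hM hdiv hA
      (fun n t ht => (((hderiv n _ (hmem t ht)).comp_const_sub x₀ t).const_smul
        ((-1 : ℝ) ^ n)).congr_deriv (by rw [pow_succ, mul_neg_one, neg_smul, smul_neg]))
      (fun n hn t ht => by
        rw [norm_smul, norm_pow, norm_neg, norm_one, one_pow, one_mul]
        exact hbound n hn _ (hmem t ht)) (fun n => by simpa using hflat n)
    simpa [hD] using h
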